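/- If there exists N ∈ ℕ with m_N < 1, then the series Σ_{t=1}^∞ m_t converges; moreover, with α := m_N < 1 and M := max_{0 ≤ i ≤ N} m_i, one has Σ_{t=1}^∞ m_t ≤ N·M/(1−α) < ∞. -/

import Mathlib

open MeasureTheory ProbabilityTheory Filter Topology

/-- `expProd Q β n z` is the expectation `E_z[∏_{t=0}^{n-1} β(Z_t)]` of the product of
discount factors along the Markov chain generated by the kernel `Q` and started at `z`,
encoded by the canonical iterated-integral recursion (the empty product is `1`). -/
noncomputable def expProd {Z : Type*} [MeasurableSpace Z] (Q : ProbabilityTheory.Kernel Z Z)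
    (β : Z → ℝ) : ℕ → Z → ℝ
  | 0 => fun _ => 1
  | n + 1 => fun z => β z * ∫ z', expProd Q β n z' ∂(Q z)

/-- `mSup Q β n = sup_{z ∈ Z} E_z[∏_{t=0}^{n-1} β(Z_t)]`. -/
noncomputable def mSup {Z : Type*} [MeasurableSpace Z] (Q : ProbabilityTheory.Kernel Z Z)
    (β : Z → ℝ) (n : ℕ) : ℝ :=
  ⨆ z, expProd Q β n z

section

variable {Z : Type*} [MeasurableSpace Z] (Q : ProbabilityTheory.Kernel Z Z) {β : Z → ℝ}

lemma measurable_expProd [IsMarkovKernel Q] (hβm : Measurable β) (n : ℕ) :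
    Measurable (expProd Q β n) := by
  induction n with
  | zero => exact measurable_const
  | succ n ih => exact hβm.mul ih.stronglyMeasurable.integral_kernel.measurable

lemma expProd_nonneg (hβ0 : ∀ z, 0 ≤ β z) (n : ℕ) (z : Z) : 0 ≤ expProd Q β n z := by
  induction n generalizing z with
  | zero => exact zero_le_one
  | succ n ih => exact mul_nonneg (hβ0 z) (integral_nonneg ih)

lemma integrable_of_nonneg_of_le {f : Z → ℝ} (μ : Measure Z) [IsFiniteMeasure μ]
    (hf : Measurable f) (hf0 : ∀ z, 0 ≤ f z) {C : ℝ} (hfC : ∀ z, f z ≤ C) :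
    Integrable f μ :=
  Integrable.of_bound hf.aestronglyMeasurable C
    (ae_of_all _ fun z => by rw [Real.norm_of_nonneg (hf0 z)]; exact hfC z)

lemma expProd_le_pow [IsMarkovKernel Q] (hβm : Measurable β) (hβ0 : ∀ z, 0 ≤ β z)
    {C : ℝ} (hC0 : 0 ≤ C) (hC : ∀ z, β z ≤ C) (n : ℕ) (z : Z) :
    expProd Q β n z ≤ C ^ n := by
  induction n generalizing z with
  | zero => simp [expProd]
  | succ n ih =>
    have h : ∫ z', expProd Q β n z' ∂(Q z) ≤ C ^ n := by
      simpa using integral_mono (integrable_of_nonneg_of_le (Q z) (measurable_expProd Q hβm n)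
        (expProd_nonneg Q hβ0 n) ih) (integrable_const (C ^ n)) ih
    rw [pow_succ']
    exact mul_le_mul (hC z) h (integral_nonneg (expProd_nonneg Q hβ0 n)) hC0

lemma bddAbove_range_expProd [IsMarkovKernel Q] (hβm : Measurable β) (hβ0 : ∀ z, 0 ≤ β z)
    (hβb : ∃ C, ∀ z, β z ≤ C) (n : ℕ) : BddAbove (Set.range (expProd Q β n)) := by
  obtain ⟨C, hC⟩ := hβb
  exact ⟨(max C 0) ^ n, Set.forall_mem_range.2 fun z => expProd_le_pow Q hβm hβ0
    (le_max_right C 0) (fun z => (hC z).trans (le_max_left C 0)) n z⟩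

lemma expProd_le_mSup [IsMarkovKernel Q] (hβm : Measurable β) (hβ0 : ∀ z, 0 ≤ β z)
    (hβb : ∃ C, ∀ z, β z ≤ C) (n : ℕ) (z : Z) : expProd Q β n z ≤ mSup Q β n :=
  le_ciSup (bddAbove_range_expProd Q hβm hβ0 hβb n) z

lemma mSup_nonneg (hβ0 : ∀ z, 0 ≤ β z) (n : ℕ) : 0 ≤ mSup Q β n :=
  Real.iSup_nonneg (expProd_nonneg Q hβ0 n)

lemma expProd_add_le [IsMarkovKernel Q] (hβm : Measurable β) (hβ0 : ∀ z, 0 ≤ β z)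
    (hβb : ∃ C, ∀ z, β z ≤ C) (a b : ℕ) (z : Z) :
    expProd Q β (a + b) z ≤ mSup Q β b * expProd Q β a z := by
  have hint (n : ℕ) (z : Z) : Integrable (expProd Q β n) (Q z) :=
    integrable_of_nonneg_of_le (Q z) (measurable_expProd Q hβm n) (expProd_nonneg Q hβ0 n)
      (expProd_le_mSup Q hβm hβ0 hβb n)
  induction a generalizing z with
  | zero => simpa [expProd] using expProd_le_mSup Q hβm hβ0 hβb b z
  | succ a ih =>
    rw [add_right_comm]
    calc β z * ∫ z', expProd Q β (a + b) z' ∂(Q z)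
        ≤ β z * ∫ z', mSup Q β b * expProd Q β a z' ∂(Q z) :=
          mul_le_mul_of_nonneg_left
            (integral_mono (hint (a + b) z) ((hint a z).const_mul _) ih) (hβ0 z)
      _ = mSup Q β b * expProd Q β (a + 1) z := by
          rw [integral_const_mul, expProd]; ring

lemma mSup_add_le [Nonempty Z] [IsMarkovKernel Q] (hβm : Measurable β) (hβ0 : ∀ z, 0 ≤ β z)
    (hβb : ∃ C, ∀ z, β z ≤ C) (a b : ℕ) :
    mSup Q β (a + b) ≤ mSup Q β b * mSup Q β a :=
  ciSup_le fun z => (expProd_add_le Q hβm hβ0 hβb a b z).trans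
    (mul_le_mul_of_nonneg_left (expProd_le_mSup Q hβm hβ0 hβb a z) (mSup_nonneg Q hβ0 b))

end

lemma sum_range_le_div_of_add_le_mul {u : ℕ → ℝ} (hu : ∀ n, 0 ≤ u n) {α : ℝ} (hα : α < 1)
    {N : ℕ} (h : ∀ n, u (n + N) ≤ α * u n) (n : ℕ) :
    ∑ t ∈ Finset.range n, u t ≤ (∑ t ∈ Finset.range N, u t) / (1 - α) := by
  have h₁ : ∑ t ∈ Finset.range n, u t ≤ ∑ t ∈ Finset.range (N + n), u t :=
    Finset.sum_le_sum_of_subset_of_nonneg (Finset.range_mono (Nat.le_add_left n N))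
      fun t _ _ => hu t
  have h₂ : ∑ t ∈ Finset.range n, u (N + t) ≤ α * ∑ t ∈ Finset.range n, u t := by
    rw [Finset.mul_sum]
    exact Finset.sum_le_sum fun t _ => add_comm t N ▸ h t
  rw [Finset.sum_range_add] at h₁
  rw [le_div_iff₀ (sub_pos.2 hα)]
  linarith

/-- If `m_N < 1` for some `N`, then the series `Σ_{t=1}^∞ m_t` converges, and with
`α := m_N` and `M := max_{0 ≤ i ≤ N} m_i` one has `Σ_{t=1}^∞ m_t ≤ N·M/(1−α) < ∞`. -/
theorem summable_mSup {Z : Type*} [MetricSpace Z] [MeasurableSpace Z] [BorelSpace Z]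
    [Nonempty Z]
    (Q : ProbabilityTheory.Kernel Z Z) [IsMarkovKernel Q]
    (β : Z → ℝ) (hβm : Measurable β) (hβ0 : ∀ z, 0 ≤ β z) (hβb : ∃ C, ∀ z, β z ≤ C)
    (N : ℕ) (hN : mSup Q β N < 1) :
    Summable (fun t : ℕ => mSup Q β (t + 1)) ∧
      ∑' t : ℕ, mSup Q β (t + 1) ≤
        (N : ℝ) *
          ((Finset.range (N + 1)).sup' Finset.nonempty_range_add_one fun i => mSup Q β i) /
          (1 - mSup Q β N) := by
  have hsum := sum_range_le_div_of_add_le_mul (u := fun t => mSup Q β (t + 1))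
    (fun t => mSup_nonneg Q hβ0 (t + 1)) hN
    fun t => Nat.add_right_comm t 1 N ▸ mSup_add_le Q hβm hβ0 hβb (t + 1) N
  refine ⟨summable_of_sum_range_le (fun t => mSup_nonneg Q hβ0 (t + 1)) hsum,
    (Real.tsum_le_of_sum_range_le (fun t => mSup_nonneg Q hβ0 (t + 1)) hsum).trans ?_⟩
  refine div_le_div_of_nonneg_right ?_ (sub_pos.2 hN).le
  simpa using Finset.sum_le_card_nsmul (Finset.range N) (fun t => mSup Q β (t + 1)) _
    fun t ht => Finset.le_sup' (fun i => mSup Q β i)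
      (Finset.mem_range.2 (Nat.succ_lt_succ (Finset.mem_range.1 ht)))
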